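/- (Kalton.) Let E and X be real Banach spaces. If E and X are reflexive and every bounded linear operator from E to X is compact, then the Banach space B(E,X) of bounded linear operators is reflexive. -/

import Mathlib

open NormedSpace
open Filter Topology MeasureTheory CompactlySupported

section Auxiliary

variable {K : Type*} [TopologicalSpace K] [CompactSpace K]
  {Y : Type*} [NormedAddCommGroup Y] [NormedSpace ℝ Y]

/-- Bounded convergence for positive functionals on `C(K, ℝ)`. -/
lemma tendsto_positive_functional_of_bounded_pointwise [T2Space K] (l : C(K, ℝ) →ₗ[ℝ] ℝ)
    (hl : ∀ f, 0 ≤ f → 0 ≤ l f) (f : ℕ → C(K, ℝ)) (C : ℝ) (hC : ∀ n k, |f n k| ≤ C)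
    (hf : ∀ k, Tendsto (fun n => f n k) atTop (𝓝 0)) :
    Tendsto (fun n => l (f n)) atTop (𝓝 0) := by
  borelize K
  let L : C_c(K, ℝ) →ₗ[ℝ] ℝ :=
    { toFun := fun g => l g.toContinuousMap
      map_add' := fun g h => l.map_add _ _
      map_smul' := fun c g => l.map_smul _ _ }
  let Λ : C_c(K, ℝ) →ₚ[ℝ] ℝ := PositiveLinearMap.mk₀ L (fun g hg => hl _ hg)
  have key : ∀ g : C(K, ℝ), l g = ∫ x, g x ∂(RealRMK.rieszMeasure Λ) := fun g =>
    (RealRMK.integral_rieszMeasure Λ (CompactlySupportedContinuousMap.continuousMapEquiv g)).symm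
  have hfin : IsFiniteMeasure (RealRMK.rieszMeasure Λ) :=
    ⟨isCompact_univ.measure_lt_top⟩
  simp only [key]
  have := tendsto_integral_of_dominated_convergence (μ := RealRMK.rieszMeasure Λ)
    (F := fun n x => f n x) (f := fun _ => (0 : ℝ)) (fun _ => C)
    (fun n => (f n).continuous.aestronglyMeasurable) (integrable_const C)
    (fun n => ae_of_all _ fun x => by simpa using hC n x) (ae_of_all _ hf)
  simpa using this

/-- A bounded sequence tending pointwise to zero has convex combinations that are uniformly
small. -/
lemma exists_mem_convexHull_small [T2Space K] (J : Y →ₗ[ℝ] C(K, ℝ)) (T : ℕ → Y) (C : ℝ)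
    (hC : ∀ n k, |J (T n) k| ≤ C) (hT : ∀ k, Tendsto (fun n => J (T n) k) atTop (𝓝 0))
    {ε : ℝ} (hε : 0 < ε) : ∃ y ∈ convexHull ℝ (Set.range T), ∀ k, |J y k| < ε := by
  let A : Set C(K, ℝ) := {h | ∃ y ∈ convexHull ℝ (Set.range T), ∀ k, |J y k| ≤ h k}
  have hA : Convex ℝ A := by
    rintro h₁ ⟨y₁, hy₁, h1⟩ h₂ ⟨y₂, hy₂, h2⟩ a b ha hb hab
    refine ⟨a • y₁ + b • y₂, convex_convexHull ℝ _ hy₁ hy₂ ha hb hab, fun k => ?_⟩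
    simp only [map_add, map_smul, ContinuousMap.add_apply, ContinuousMap.smul_apply, smul_eq_mul]
    calc |a * J y₁ k + b * J y₂ k| ≤ |a * J y₁ k| + |b * J y₂ k| := abs_add_le _ _
      _ = a * |J y₁ k| + b * |J y₂ k| := by rw [abs_mul, abs_mul, abs_of_nonneg ha, abs_of_nonneg hb]
      _ ≤ a * h₁ k + b * h₂ k := by gcongr <;> simp [h1, h2]
  have habs : ∀ n, ∀ p : C(K, ℝ), 0 ≤ p → |J (T n)| + p ∈ A := fun n p hp =>
    ⟨T n, subset_convexHull ℝ _ ⟨n, rfl⟩, fun k => by simpa using hp k⟩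
  by_cases hd : Disjoint (Metric.ball (0 : C(K, ℝ)) ε) A
  · exfalso
    obtain ⟨l, s, hl1, hl2⟩ :=
      geometric_hahn_banach_open (convex_ball _ _) Metric.isOpen_ball hA hd
    have hs : 0 < s := by simpa using hl1 0 (by simpa using hε)
    have hpos : ∀ p, 0 ≤ p → 0 ≤ l p := by
      intro p hp
      by_contra! hneg
      obtain ⟨t, ht⟩ := exists_nat_gt ((l |J (T 0)|) / (-l p))
      have h1 := hl2 _ (habs 0 ((t : ℝ) • p) (smul_nonneg (by positivity) hp))
      rw [div_lt_iff₀ (by linarith)] at ht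
      simp only [map_add, map_smul, smul_eq_mul] at h1
      linarith
    have := tendsto_positive_functional_of_bounded_pointwise l.toLinearMap hpos
      (fun n => |J (T n)|) C (fun n k => by simpa using hC n k)
      (fun k => by simpa using (hT k).abs)
    have h3 : s ≤ 0 := ge_of_tendsto' this fun n => by simpa using hl2 _ (habs n 0 le_rfl)
    linarith
  · obtain ⟨h, hh, y, hy, hk⟩ := Set.not_disjoint_iff.1 hd
    refine ⟨y, hy, fun k => (hk k).trans_lt ?_⟩
    rw [mem_ball_zero_iff] at hh
    exact ((le_abs_self _).trans (h.norm_coe_le_norm k)).trans_lt hh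

/-- A form of Goldstine's theorem: an element of the bidual is approximated, on finitely many
functionals, by elements of the space with controlled norm. -/
lemma exists_approx_bidual (G : StrongDual ℝ (StrongDual ℝ Y)) (s : Finset (StrongDual ℝ Y))
    {ε : ℝ} (hε : 0 < ε) : ∃ y : Y, ‖y‖ ≤ ‖G‖ + 1 ∧ ∀ f ∈ s, |f y - G f| < ε := by
  classical
  let Φ : Y →L[ℝ] (s → ℝ) := ContinuousLinearMap.pi fun f => f.1
  let v : s → ℝ := fun f => G f.1
  have hv : v ∈ closure (Φ '' Metric.ball 0 (‖G‖ + 1)) := by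
    by_contra hv
    obtain ⟨l, u, h1, h2⟩ := geometric_hahn_banach_point_closed
      (((convex_ball (0 : Y) (‖G‖ + 1)).linear_image Φ.toLinearMap).closure) isClosed_closure hv
    let ψ : StrongDual ℝ Y := l.comp Φ
    have hlv : ∀ w : s → ℝ, l w = ∑ f, w f * l (Pi.single f 1) := fun w => by
      conv_lhs => rw [← Finset.univ_sum_single w]
      rw [map_sum]
      refine Finset.sum_congr rfl fun f _ => ?_
      rw [← smul_eq_mul, ← map_smul, ← Pi.single_smul, smul_eq_mul, mul_one]
    have hψ : ψ = ∑ f : s, l (Pi.single f 1) • f.1 := by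
      ext y
      simp only [ψ, ContinuousLinearMap.comp_apply, hlv (Φ y)]
      simp [Φ, mul_comm]
    have hG : G ψ = l v := by
      rw [hψ, hlv v]
      simp [v, mul_comm]
    have hR : 0 < ‖G‖ + 1 := by positivity
    have hb : ∀ y : Y, ‖y‖ < ‖G‖ + 1 → u < ψ y := fun y hy =>
      h2 _ (subset_closure ⟨y, by simpa using hy, rfl⟩)
    have hu : u < 0 := by simpa using hb 0 (by simpa using hR)
    have hn : ‖ψ‖ ≤ -u / (‖G‖ + 1) := by
      by_contra! hlt
      obtain ⟨x, hx, hx'⟩ := ψ.exists_lt_apply_of_lt_opNorm hlt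
      have hz : ∀ c : ℝ, |c| = ‖G‖ + 1 → u < c * ψ x := fun c hc => by
        simpa using hb (c • x) (by rw [norm_smul, Real.norm_eq_abs, hc]; nlinarith)
      have e1 := hz (‖G‖ + 1) (abs_of_pos hR)
      have e2 := hz (-(‖G‖ + 1)) (by rw [abs_neg, abs_of_pos hR])
      rw [div_lt_iff₀ hR, Real.norm_eq_abs] at hx'
      rcases abs_cases (ψ x) with ⟨h, _⟩ | ⟨h, _⟩ <;> rw [h] at hx' <;> nlinarith
    rw [le_div_iff₀ hR] at hn
    have h3 := (abs_le.1 (G.le_opNorm ψ)).1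
    rw [hG] at h3
    nlinarith [norm_nonneg ψ]
  obtain ⟨_, ⟨y, hy, rfl⟩, hd⟩ := Metric.mem_closure_iff.1 hv ε hε
  refine ⟨y, by simpa using (mem_ball_zero_iff.1 hy).le, fun f hf => ?_⟩
  have := (dist_pi_lt_iff hε).1 hd ⟨f, hf⟩
  rw [dist_comm, Real.dist_eq] at this
  exact this

/-- Finitely many continuous functions on a compact space are uniformly approximated by their values
on a finite set. -/
lemma exists_finset_approx (A : Finset C(K, ℝ)) {ε : ℝ} (hε : 0 < ε) :
    ∃ F : Finset K, ∀ k, ∃ d ∈ F, ∀ f ∈ A, |f d - f k| < ε := by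
  let U : K → Set K := fun d => {k | ∀ f ∈ A, |f d - f k| < ε}
  have hU : ∀ d, U d ∈ 𝓝 d := fun d => by
    refine IsOpen.mem_nhds ?_ (fun f _ => by simpa using hε)
    have : U d = ⋂ f ∈ A, {k | |f d - f k| < ε} := by ext; simp [U]
    rw [this]
    exact isOpen_biInter_finset fun f _ => isOpen_lt (by fun_prop) continuous_const
  obtain ⟨F, -, hF⟩ := isCompact_univ.elim_nhds_subcover U fun d _ => hU d
  refine ⟨F, fun k => ?_⟩
  simpa [U] using hF (Set.mem_univ k)

/-- The sequence used in an Eberlein-type argument: if `G` in the bidual vanishes on all point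
evaluations, there is a bounded sequence `T` along which `φ` tends to `G φ` while `T` tends to zero
on points which are asymptotically dense for the sequence itself. -/
lemma exists_seq_vanishing (J : Y →L[ℝ] C(K, ℝ)) (G : StrongDual ℝ (StrongDual ℝ Y))
    (hG : ∀ k, G ((ContinuousMap.evalCLM ℝ k).comp J) = 0) (φ : StrongDual ℝ Y) :
    ∃ (T : ℕ → Y) (D : ℕ → Finset K), (∀ n, ‖T n‖ ≤ ‖G‖ + 1) ∧
      (∀ n, |φ (T n) - G φ| < 1 / ((n : ℝ) + 1)) ∧
      (∀ m n, m ≤ n → ∀ d ∈ D m, |J (T n) d| < 1 / ((n : ℝ) + 1)) ∧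
      ∀ k n, ∃ d ∈ D n, ∀ i < n, |J (T i) d - J (T i) k| < 1 / ((n : ℝ) + 1) := by
  classical
  have hT : ∀ (F : Finset K) (n : ℕ), ∃ y : Y, ‖y‖ ≤ ‖G‖ + 1 ∧
      |φ y - G φ| < 1 / ((n : ℝ) + 1) ∧ ∀ d ∈ F, |J y d| < 1 / ((n : ℝ) + 1) := by
    intro F n
    obtain ⟨y, h1, h2⟩ := exists_approx_bidual G
      (insert φ (F.image fun k => (ContinuousMap.evalCLM ℝ k).comp J))
      (Nat.one_div_pos_of_nat (α := ℝ) (n := n))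
    refine ⟨y, h1, h2 φ (Finset.mem_insert_self _ _), fun d hd => ?_⟩
    simpa [hG] using h2 _ (Finset.mem_insert_of_mem (Finset.mem_image_of_mem _ hd))
  have hF : ∀ (A : Finset Y) (n : ℕ), ∃ F : Finset K, ∀ k, ∃ d ∈ F, ∀ y ∈ A,
      |J y d - J y k| < 1 / ((n : ℝ) + 1) := by
    intro A n
    obtain ⟨F, h⟩ := exists_finset_approx (A.image J) (Nat.one_div_pos_of_nat (α := ℝ) (n := n))
    refine ⟨F, fun k => ?_⟩
    obtain ⟨d, hd, h⟩ := h k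
    exact ⟨d, hd, fun y hy => h _ (Finset.mem_image_of_mem _ hy)⟩
  choose TT hTn hTφ hTF using hT
  choose FF hFF using hF
  let st : ℕ → Finset Y × Finset K := fun n => Nat.rec (∅, ∅)
    (fun n p => (insert (TT (p.2 ∪ FF p.1 n) n) p.1, p.2 ∪ FF p.1 n)) n
  have st1 : ∀ n, (st (n + 1)).1 = insert (TT (st (n + 1)).2 n) (st n).1 := fun n => rfl
  have st2 : ∀ n, (st (n + 1)).2 = (st n).2 ∪ FF (st n).1 n := fun n => rfl
  have mono1 : Monotone fun n => (st n).1 :=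
    monotone_nat_of_le_succ fun n => by rw [st1]; exact Finset.subset_insert _ _
  have mono2 : Monotone fun n => (st n).2 :=
    monotone_nat_of_le_succ fun n => by rw [st2]; exact Finset.subset_union_left
  refine ⟨fun n => TT (st (n + 1)).2 n, fun n => (st (n + 1)).2, fun n => hTn _ _,
    fun n => hTφ _ _, fun m n hmn d hd => hTF _ _ d (mono2 (Nat.succ_le_succ hmn) hd),
    fun k n => ?_⟩
  obtain ⟨d, hd, h⟩ := hFF (st n).1 n k
  refine ⟨d, ?_, fun i hi => h _ (mono1 (Nat.succ_le_of_lt hi) ?_)⟩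
  · exact Finset.mem_union_right _ hd
  · change _ ∈ (st (i + 1)).1
    rw [st1]; exact Finset.mem_insert_self _ _

/-- If point evaluations of `G` are always represented by elements of `Y`, then the sequences of
`exists_seq_vanishing` tend to zero pointwise. -/
lemma tendsto_zero_of_vanishing (J : Y →L[ℝ] C(K, ℝ))
    (h : ∀ G : StrongDual ℝ (StrongDual ℝ Y), ∃ y, ∀ k,
      G ((ContinuousMap.evalCLM ℝ k).comp J) = J y k)
    (T : ℕ → Y) (D : ℕ → Finset K) {R : ℝ} (hR : ∀ n, ‖T n‖ ≤ R)
    (hD : ∀ m n, m ≤ n → ∀ d ∈ D m, |J (T n) d| < 1 / ((n : ℝ) + 1))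
    (hd : ∀ k n, ∃ d ∈ D n, ∀ i < n, |J (T i) d - J (T i) k| < 1 / ((n : ℝ) + 1)) (k : K) :
    Tendsto (fun n => J (T n) k) atTop (𝓝 0) := by
  rw [tendsto_iff_ultrafilter]
  intro U hU
  obtain ⟨G, -, hG⟩ := (WeakDual.isCompact_closedBall (𝕜 := ℝ)
    (0 : StrongDual ℝ (StrongDual ℝ Y)) R).ultrafilter_le_nhds
    (U.map fun n => StrongDual.toWeakDual (inclusionInDoubleDual ℝ Y (T n))) (by
      rw [Filter.le_principal_iff]
      refine Filter.mem_map.2 (Filter.univ_mem' fun n => ?_)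
      simpa using (double_dual_bound ℝ Y (T n)).trans (hR n))
  obtain ⟨S, hS⟩ := h (WeakDual.toStrongDual G)
  have hlim : ∀ k, Tendsto (fun n => J (T n) k) U (𝓝 (J S k)) := fun k => by
    rw [← hS k]
    exact ((WeakDual.eval_continuous _).tendsto G).comp hG
  have hSD : ∀ m, ∀ d ∈ D m, J S d = 0 := fun m d hdm => by
    refine tendsto_nhds_unique (hlim d) (Tendsto.mono_left ?_ hU)
    refine squeeze_zero_norm' ?_ tendsto_one_div_add_atTop_nhds_zero_nat
    filter_upwards [eventually_ge_atTop m] with n hn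
    exact (hD m n hn d hdm).le
  choose d hdD hdk using hd k
  obtain ⟨k', -, hk'⟩ := (isCompact_univ (X := K)).ultrafilter_le_nhds
    ((hyperfilter ℕ).map d) (by simp)
  have hk' : Tendsto d (hyperfilter ℕ) (𝓝 k') := hk'
  have hat : (hyperfilter ℕ : Filter ℕ) ≤ atTop := Nat.hyperfilter_le_atTop
  have hTk : ∀ i, J (T i) k' = J (T i) k := fun i => by
    refine tendsto_nhds_unique (((J (T i)).continuous.tendsto k').comp hk')
      (Tendsto.mono_left ?_ hat)
    rw [tendsto_iff_norm_sub_tendsto_zero]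
    refine squeeze_zero_norm' ?_ tendsto_one_div_add_atTop_nhds_zero_nat
    filter_upwards [eventually_gt_atTop i] with n hn
    simpa using (hdk n i hn).le
  have hSk' : J S k' = 0 := by
    refine tendsto_nhds_unique (((J S).continuous.tendsto k').comp hk') ?_
    simp [Function.comp_def, hSD _ _ (hdD _)]
  have := hlim k'
  simp only [hTk, hSk'] at this
  exact this

/-- A closed subspace of `C(K, ℝ)` whose bidual elements agree with elements of the space on all
point evaluations is reflexive. -/
theorem surjective_inclusionInDoubleDual_of_embedding [T2Space K] (J : Y →L[ℝ] C(K, ℝ))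
    (hJ : ∀ y, ‖y‖ ≤ ‖J y‖)
    (h : ∀ G : StrongDual ℝ (StrongDual ℝ Y), ∃ y, ∀ k,
      G ((ContinuousMap.evalCLM ℝ k).comp J) = J y k) :
    Function.Surjective (inclusionInDoubleDual ℝ Y) := by
  intro G₀
  obtain ⟨y₀, hy₀⟩ := h G₀
  refine ⟨y₀, ?_⟩
  rw [eq_comm, ← sub_eq_zero]
  set G := G₀ - inclusionInDoubleDual ℝ Y y₀
  have hG : ∀ k, G ((ContinuousMap.evalCLM ℝ k).comp J) = 0 := fun k => by
    simp [G, hy₀]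
  by_contra hne
  obtain ⟨ψ, hψ⟩ : ∃ ψ, G ψ ≠ 0 := by
    by_contra! h0
    exact hne (ContinuousLinearMap.ext h0)
  obtain ⟨φ, hφ⟩ : ∃ φ, G φ = 2 := ⟨(2 / G ψ) • ψ, by simp [hψ]⟩
  obtain ⟨T, D, hTn, hTφ, hTD, hTd⟩ := exists_seq_vanishing J G hG φ
  have hlim := tendsto_zero_of_vanishing J h T D hTn hTD hTd
  have hC : ∀ n k, |J.toLinearMap (T n) k| ≤ ‖J‖ * (‖G‖ + 1) := fun n k =>
    ((J (T n)).norm_coe_le_norm k).trans (J.le_opNorm_of_le (hTn n))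
  have hε : 0 < 1 / (‖φ‖ + 1) := by positivity
  obtain ⟨y, hy, hyk⟩ := exists_mem_convexHull_small J.toLinearMap T _ hC hlim hε
  have hyn : ‖y‖ ≤ 1 / (‖φ‖ + 1) :=
    (hJ y).trans ((ContinuousMap.norm_le _ hε.le).2 fun k => (hyk k).le)
  have hone : convexHull ℝ (Set.range T) ⊆ {y | 1 < φ y} := by
    refine convexHull_min ?_ (convex_halfSpace_gt φ.isLinear _)
    rintro _ ⟨n, rfl⟩
    have h1 := (abs_lt.1 (hTφ n)).1
    have h2 : 1 / ((n : ℝ) + 1) ≤ 1 := by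
      rw [div_le_one (by positivity)]; simp
    simp only [Set.mem_ofPred_eq]
    linarith
  have h1 : 1 < φ y := hone hy
  have h2 : φ y ≤ ‖φ‖ * (1 / (‖φ‖ + 1)) := (le_abs_self _).trans (φ.le_opNorm_of_le hyn)
  rw [mul_one_div, le_div_iff₀ (by positivity)] at h2
  nlinarith [norm_nonneg φ]

end Auxiliary

section Operators

variable {E X : Type*} [NormedAddCommGroup E] [NormedSpace ℝ E]
  [NormedAddCommGroup X] [NormedSpace ℝ X]

/-- The closed unit ball of the dual, with the weak-star topology. -/
abbrev WeakDualBall (Z : Type*) [NormedAddCommGroup Z] [NormedSpace ℝ Z] : Type _ :=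
  (WeakDual.toStrongDual ⁻¹' Metric.closedBall (0 : StrongDual ℝ Z) 1 : Set (WeakDual ℝ Z))

instance compactSpace_weakDualBall (Z : Type*) [NormedAddCommGroup Z] [NormedSpace ℝ Z] :
    CompactSpace (WeakDualBall Z) :=
  isCompact_iff_compactSpace.1 (WeakDual.isCompact_closedBall _ _)

lemma norm_weakDualBall_le {Z : Type*} [NormedAddCommGroup Z] [NormedSpace ℝ Z]
    (p : WeakDualBall Z) : ‖WeakDual.toStrongDual p.1‖ ≤ 1 :=
  mem_closedBall_zero_iff.1 p.2

/-- A compact operator on a reflexive space is weak-to-norm continuous on the unit ball. -/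
lemma continuous_compactOperator_ball (e : E ≃ₗᵢ[ℝ] StrongDual ℝ (StrongDual ℝ E))
    (he : ∀ x f, e x f = f x) (T : E →L[ℝ] X) (hT : IsCompactOperator T) :
    Continuous fun p : WeakDualBall (StrongDual ℝ E) =>
      T (e.symm (WeakDual.toStrongDual p.1)) := by
  obtain ⟨C, hC, hTC⟩ :=
    IsCompactOperator.image_closedBall_subset_compact (f := T.toLinearMap) hT 1
  rw [continuous_iff_ultrafilter]
  intro p U hU
  obtain ⟨c, -, hc⟩ := hC.ultrafilter_le_nhds
    (U.map fun p : WeakDualBall (StrongDual ℝ E) => T (e.symm (WeakDual.toStrongDual p.1))) (by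
      rw [Filter.le_principal_iff]
      refine Filter.mem_map.2 (Filter.univ_mem' fun q => hTC ⟨_, ?_, rfl⟩)
      exact mem_closedBall_zero_iff.2 ((e.symm.norm_map _).trans_le (norm_weakDualBall_le q)))
  have hc : Tendsto (fun p : WeakDualBall (StrongDual ℝ E) =>
    T (e.symm (WeakDual.toStrongDual p.1))) U (𝓝 c) := hc
  have hpc : T (e.symm (WeakDual.toStrongDual p.1)) = c := by
    refine (SeparatingDual.eq_iff_forall_dual_eq (R := ℝ)).2 fun f => ?_
    have hf : ∀ q : WeakDualBall (StrongDual ℝ E),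
        f (T (e.symm (WeakDual.toStrongDual q.1))) = q.1 (f.comp T) := fun q => by
      have := he (e.symm (WeakDual.toStrongDual q.1)) (f.comp T)
      rw [e.apply_symm_apply] at this
      exact this.symm
    refine tendsto_nhds_unique ?_ ((f.continuous.tendsto c).comp hc)
    simp only [Function.comp_def, hf]
    exact (((WeakDual.eval_continuous (f.comp T)).comp continuous_subtype_val).tendsto p).mono_left
      hU
  rw [hpc]
  exact hc

lemma continuous_weakDualBall_apply {α : Type*} [TopologicalSpace α] {g : α → X}
    (hg : Continuous g) : Continuous fun z : α × WeakDualBall X => z.2.1 (g z.1) := by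
  rw [continuous_iff_continuousAt]
  rintro ⟨a, q⟩
  have h1 : Tendsto (fun z : α × WeakDualBall X => z.2.1 (g a)) (𝓝 (a, q)) (𝓝 (q.1 (g a))) :=
    (((WeakDual.eval_continuous (g a)).comp continuous_subtype_val).comp continuous_snd).tendsto
      (a, q)
  have h2 : Tendsto (fun z : α × WeakDualBall X => z.2.1 (g z.1 - g a)) (𝓝 (a, q)) (𝓝 0) := by
    have h3 : Tendsto (fun z : α × WeakDualBall X => ‖g z.1 - g a‖) (𝓝 (a, q)) (𝓝 0) := by
      have : Continuous fun z : α × WeakDualBall X => ‖g z.1 - g a‖ := by fun_prop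
      simpa using this.tendsto (a, q)
    refine squeeze_zero_norm (fun z => ?_) h3
    simpa using (WeakDual.toStrongDual z.2.1).le_of_opNorm_le (norm_weakDualBall_le z.2)
      (g z.1 - g a)
  simpa [ContinuousAt] using h2.add h1

/-- If every operator is compact, operators embed into continuous functions on the product of the
weak-star unit balls of `E**` and `X*`. -/
noncomputable def operatorToContinuousMap (e : E ≃ₗᵢ[ℝ] StrongDual ℝ (StrongDual ℝ E))
    (he : ∀ x f, e x f = f x) (hK : ∀ T : E →L[ℝ] X, IsCompactOperator T) :
    (E →L[ℝ] X) →L[ℝ] C(WeakDualBall (StrongDual ℝ E) × WeakDualBall X, ℝ) :=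
  LinearMap.mkContinuous
    { toFun := fun T => ⟨fun z => z.2.1 (T (e.symm (WeakDual.toStrongDual z.1.1))),
        continuous_weakDualBall_apply (continuous_compactOperator_ball e he T (hK T))⟩
      map_add' := fun S T => by ext z; simp
      map_smul' := fun c T => by ext z; simp } 1 fun T => by
    rw [ContinuousMap.norm_le _ (by positivity)]
    intro z
    have h1 := (WeakDual.toStrongDual z.2.1).le_of_opNorm_le (norm_weakDualBall_le z.2)
      (T (e.symm (WeakDual.toStrongDual z.1.1)))
    have h2 := T.le_opNorm_of_le (c := 1) (x := e.symm (WeakDual.toStrongDual z.1.1))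
      ((e.symm.norm_map _).trans_le (norm_weakDualBall_le z.1))
    simp only [one_mul, mul_one] at h1 h2 ⊢
    exact h1.trans h2

lemma norm_le_operatorToContinuousMap (e : E ≃ₗᵢ[ℝ] StrongDual ℝ (StrongDual ℝ E))
    (he : ∀ x f, e x f = f x) (hK : ∀ T : E →L[ℝ] X, IsCompactOperator T) (T : E →L[ℝ] X) :
    ‖T‖ ≤ ‖operatorToContinuousMap e he hK T‖ := by
  refine T.opNorm_le_of_unit_norm (norm_nonneg _) fun x hx => ?_
  obtain ⟨f, hf, hfx⟩ := exists_dual_vector'' ℝ (T x)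
  let p : WeakDualBall (StrongDual ℝ E) := ⟨StrongDual.toWeakDual (e x),
    mem_closedBall_zero_iff.2 ((e.norm_map x).trans_le hx.le)⟩
  let q : WeakDualBall X := ⟨StrongDual.toWeakDual f, by simpa using hf⟩
  have h1 : operatorToContinuousMap e he hK T (p, q) = f (T (e.symm (e x))) := rfl
  have h2 := (operatorToContinuousMap e he hK T).norm_coe_le_norm (p, q)
  rw [h1, e.symm_apply_apply, hfx] at h2
  simpa using h2

end Operators

/-- **Kalton.** If `E` and `X` are reflexive real Banach spaces and every bounded linear
operator `E → X` is compact, then `B(E,X)` is reflexive. -/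
theorem kalton_reflexivity (E X : Type*)
    [NormedAddCommGroup E] [NormedSpace ℝ E] [CompleteSpace E]
    [NormedAddCommGroup X] [NormedSpace ℝ X] [CompleteSpace X]
    (hE : Function.Surjective (inclusionInDoubleDual ℝ E))
    (hX : Function.Surjective (inclusionInDoubleDual ℝ X))
    (hK : ∀ T : E →L[ℝ] X, IsCompactOperator T) :
    Function.Surjective (inclusionInDoubleDual ℝ (E →L[ℝ] X)) := by
  let e := LinearIsometryEquiv.ofSurjective (inclusionInDoubleDualLi ℝ (E := E)) hE
  let eX := LinearIsometryEquiv.ofSurjective (inclusionInDoubleDualLi ℝ (E := X)) hX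
  have he : ∀ x f, e x f = f x := fun x f => rfl
  refine surjective_inclusionInDoubleDual_of_embedding (operatorToContinuousMap e he hK)
    (norm_le_operatorToContinuousMap e he hK) fun G => ?_
  let B : E →L[ℝ] StrongDual ℝ X →L[ℝ] StrongDual ℝ (E →L[ℝ] X) :=
    (ContinuousLinearMap.compL ℝ (E →L[ℝ] X) X ℝ).flip.comp (ContinuousLinearMap.apply ℝ X)
  let S : E →L[ℝ] StrongDual ℝ (StrongDual ℝ X) :=
    (ContinuousLinearMap.compL ℝ (StrongDual ℝ X) (StrongDual ℝ (E →L[ℝ] X)) ℝ G).comp B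
  refine ⟨(eX.symm : StrongDual ℝ (StrongDual ℝ X) →L[ℝ] X).comp S, ?_⟩
  rintro ⟨p, q⟩
  have h1 : ∀ (s : StrongDual ℝ (StrongDual ℝ X)) (f : StrongDual ℝ X), f (eX.symm s) = s f :=
    fun s f => by
      conv_rhs => rw [← eX.apply_symm_apply s]
      rfl
  exact (h1 (S (e.symm (WeakDual.toStrongDual p.1))) (WeakDual.toStrongDual q.1)).symm
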